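/- For every integer k ≥ 2, the greatest common divisor of the binomial coefficients C(k,i) over i ∈ {1, …, k−1} equals p if k = p^n for some prime p and some n ∈ ℕ, and equals 1 otherwise. -/

import Mathlib

/-- **Lemma (consequence of Lucas' Lemma).**  For every integer `k ≥ 2`, the greatest common
divisor of the binomial coefficients `C(k, i)` for `i ∈ {1, …, k-1}` equals `p` if `k = pⁿ`
for some prime `p` and some `n ∈ ℕ`, and equals `1` otherwise. -/
theorem gcd_choose_eq_prime_of_prime_pow (k : ℕ) (hk : 2 ≤ k) :
    (∀ p n : ℕ, p.Prime → k = p ^ n →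
      (Finset.Ioo 0 k).gcd (fun i => k.choose i) = p) ∧
    ((¬ ∃ p n : ℕ, p.Prime ∧ k = p ^ n) →
      (Finset.Ioo 0 k).gcd (fun i => k.choose i) = 1) := by
  have hIoo : Finset.Ioo 0 k = Finset.Icc 1 (k - 1) := by
    ext i
    simp only [Finset.mem_Ioo, Finset.mem_Icc]
    omega
  rw [hIoo]
  refine ⟨fun p n hp hkp => ?_, fun h => ?_⟩
  · have hn : n ≠ 0 := by
      rintro rfl
      simp at hkp
      omega
    have hpow : IsPrimePow k := hkp ▸ hp.isPrimePow.pow hn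
    rw [Choose.gcd_choose_eq_minFac_of_isPrimePow hpow, hkp, hp.pow_minFac hn]
  · refine Choose.gcd_choose_eq_one_of_not_isPrimePow (by omega) fun hpow => h ?_
    obtain ⟨p, n, hp, -, hpn⟩ := (isPrimePow_nat_iff k).mp hpow
    exact ⟨p, n, hp, hpn.symm⟩
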